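/- Let H be a d-uniform hypergraph and K a d'-uniform hypergraph on disjoint vertex sets, both with edge ideals having linear resolutions over a field k. Then the product hypergraph H·K is (d+d')-uniform and its edge ideal also has a linear resolution. Conversely, if H·K has a linear resolution then so do both H and K. -/

import Mathlib

set_option maxSynthPendingDepth 2

open Finset

/-- The module of simplicial `i`-chains (spanned by faces of cardinality `i`). -/
abbrev Chains (k : Type) [Field k] {V : Type} [LinearOrder V]
    (K : Set (Finset V)) (i : ℕ) : Type :=
  {F : Finset V // F ∈ K ∧ F.card = i} →₀ k

open scoped Classical in
/-- Boundary of a basis face. -/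
noncomputable def elemBoundary (k : Type) [Field k] {V : Type} [LinearOrder V]
    (K : Set (Finset V)) (i : ℕ) (F : {F : Finset V // F ∈ K ∧ F.card = i + 1}) :
    Chains k K i :=
  ∑ x ∈ F.1.attach,
    if h : F.1.erase x.1 ∈ K then
      ((-1 : k) ^ (F.1.filter (fun y => y < x.1)).card) •
        Finsupp.single ⟨F.1.erase x.1, ⟨h, by
          simp [Finset.card_erase_of_mem x.2, F.2.2]⟩⟩ (1 : k)
    else 0

/-- The simplicial boundary map from `(i+1)`-chains to `i`-chains. -/
noncomputable def boundary (k : Type) [Field k] {V : Type} [LinearOrder V]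
    (K : Set (Finset V)) (i : ℕ) : Chains k K (i + 1) →ₗ[k] Chains k K i :=
  Finsupp.lsum k fun F => LinearMap.toSpanSingleton k _ (elemBoundary k K i F)

/-- The cycles in cardinality-index `i` (everything in index `0`). -/
noncomputable def cyclesMod (k : Type) [Field k] {V : Type} [LinearOrder V]
    (K : Set (Finset V)) : (i : ℕ) → Submodule k (Chains k K i)
  | 0 => ⊤
  | (i + 1) => LinearMap.ker (boundary k K i)

/-- Reduced simplicial homology with coefficients in `k`, indexed so that
`redHomology k K i` is `H̃_{i-1}(K; k)` (faces of cardinality `i` sit in index `i`). -/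
noncomputable abbrev redHomology (k : Type) [Field k] {V : Type} [LinearOrder V]
    (K : Set (Finset V)) (i : ℕ) :=
  cyclesMod k K i ⧸
    (LinearMap.range (boundary k K i)).comap (cyclesMod k K i).subtype

/-- The restriction `K_W` of a complex to a vertex subset `W`. -/
def restrictC {V : Type} (K : Set (Finset V)) (W : Finset V) : Set (Finset V) :=
  {F | F ∈ K ∧ F ⊆ W}

open scoped Classical in
/-- The `(i,j)`-th graded Betti number of (the Stanley–Reisner ring of) a simplicial
complex `K` with vertex set `Y`, given by Hochster's formula:
`β_{i,j} = ∑_{W ⊆ Y, |W| = j} dim_k H̃_{j-i-1}(K_W; k)` (and `0` for `i > j`). -/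
noncomputable def betti (k : Type) [Field k] {V : Type} [LinearOrder V]
    (K : Set (Finset V)) (Y : Finset V) (i j : ℕ) : ℕ :=
  if i ≤ j then
    ∑ W ∈ Y.powerset.filter (fun W => W.card = j),
      Module.finrank k (redHomology k (restrictC K W) (j - i))
  else 0

/-- The independence complex of a hypergraph with edge set `E`. -/
def indepComplex {V : Type} (E : Set (Finset V)) : Set (Finset V) :=
  {F | ∀ e ∈ E, ¬ e ⊆ F}

/-- The product of hypergraphs on disjoint vertex sets: edges are unions of one edge
from each factor. -/
def prodH {n m : ℕ} (E1 : Set (Finset (Fin n))) (E2 : Set (Finset (Fin m))) :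
    Set (Finset (Fin (n + m))) :=
  {S | ∃ e ∈ E1, ∃ f ∈ E2, S = e.image (Fin.castAdd m) ∪ f.image (Fin.natAdd n)}

/-- A hypergraph on `Fin n` (with edge ideal generated in degree `e`) has a linear
resolution: `β_{i,j} = 0` for `i > 0` unless `j = i + e - 1`. -/
def HasLinearRes (k : Type) [Field k] {n : ℕ} (E : Set (Finset (Fin n))) (e : ℕ) : Prop :=
  ∀ i j : ℕ, 0 < i → j ≠ i + e - 1 →
    betti k (indepComplex E) Finset.univ i j = 0

section Abstract
open Matrix Kronecker

variable {k : Type} [Field k] {X Y : Type} [Fintype X] [DecidableEq X] [Fintype Y] [DecidableEq Y]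

/-- Exactness in degree `q` of the complex spanned by the elements satisfying `P`. -/
def ExactAt (D : Matrix X X k) (P : X → Prop) (deg : X → ℕ) (q : ℕ) : Prop :=
  ∀ v : X → k, (∀ x, ¬ (P x ∧ deg x = q) → v x = 0) → D *ᵥ v = 0 → ∃ u, D *ᵥ u = v

open scoped Classical in
/-- Projection to the span of the elements satisfying `P`. -/
noncomputable def piM (k : Type) [Field k] (P : X → Prop) : Matrix X X k :=
  Matrix.diagonal (fun x => if P x then 1 else 0)

/-- The sign operator. -/
def epsM (k : Type) [Field k] (deg : X → ℕ) : Matrix X X k :=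
  Matrix.diagonal (fun x => (-1) ^ deg x)

theorem piM_idem (P : X → Prop) : piM k P * piM k P = piM k P := by
  simp [piM, Matrix.diagonal_mul_diagonal]

theorem epsM_sq (deg : X → ℕ) : epsM k deg * epsM k deg = 1 := by
  simp [epsM, Matrix.diagonal_mul_diagonal, ← mul_pow]

theorem piM_eps (P : X → Prop) (deg : X → ℕ) :
    piM k P * epsM k deg = epsM k deg * piM k P := by
  simp [piM, epsM, Matrix.diagonal_mul_diagonal, mul_comm]

theorem piM_mul_of (P : X → Prop) (M : Matrix X X k) (h : ∀ x y, M x y ≠ 0 → P x) :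
    piM k P * M = M := by
  ext x y
  have := h x y
  simp only [piM, Matrix.diagonal_mul]
  split_ifs with hp
  · simp
  · by_contra h0
    exact hp (this (fun h1 => h0 (by simp [h1])))

theorem mul_piM_of (P : X → Prop) (M : Matrix X X k) (h : ∀ x y, M x y ≠ 0 → P y) :
    M * piM k P = M := by
  ext x y
  have := h x y
  simp only [piM, Matrix.mul_diagonal]
  split_ifs with hp
  · simp
  · by_contra h0
    exact hp (this (fun h1 => h0 (by simp [h1])))

theorem eps_anti (deg : X → ℕ) (M : Matrix X X k)
    (h : ∀ x y, M x y ≠ 0 → deg y = deg x + 1 ∨ deg x = deg y + 1) :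
    epsM k deg * M = - (M * epsM k deg) := by
  ext x y
  simp only [epsM, Matrix.diagonal_mul, Matrix.mul_diagonal, Matrix.neg_apply]
  by_cases h0 : M x y = 0
  · simp [h0]
  · rcases h x y h0 with h1 | h1 <;> rw [h1, pow_succ] <;> ring

theorem exists_geninv (D : Matrix X X k) : ∃ S : Matrix X X k, D * S * D = D := by
  let f := Matrix.toLin' D
  obtain ⟨r, hr⟩ := f.rangeRestrict.exists_rightInverse_of_surjective f.range_rangeRestrict
  obtain ⟨g, hg⟩ := LinearMap.exists_extend r
  refine ⟨LinearMap.toMatrix' g, ?_⟩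
  apply Matrix.toLin'.injective
  rw [Matrix.toLin'_mul, Matrix.toLin'_mul, Matrix.toLin'_toMatrix']
  apply LinearMap.ext
  intro v
  have h1 : g (f v) = r (f.rangeRestrict v) := by
    rw [← hg]; rfl
  have h2 : f.rangeRestrict (r (f.rangeRestrict v)) = f.rangeRestrict v := by
    exact LinearMap.congr_fun hr (f.rangeRestrict v)
  have h3 := congrArg Subtype.val h2
  change f (g (f v)) = f v
  rw [h1]; exact h3

theorem exists_homotopy (D : Matrix X X k) (P : X → Prop) (deg : X → ℕ) (a : ℕ)
    (hD : ∀ x y, D x y ≠ 0 → P x ∧ P y ∧ deg y = deg x + 1) (hDD : D * D = 0)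
    (hex : ∀ q, q ≠ a → ExactAt D P deg q) :
    ∃ h p : Matrix X X k, D * h + h * D = piM k P - p ∧ D * p = 0 ∧ p * D = 0 ∧
      piM k P * h = h ∧ h * piM k P = h ∧ piM k P * p = p ∧ p * piM k P = p ∧
      epsM k deg * h = - (h * epsM k deg) ∧
      epsM k deg * p = p * epsM k deg ∧ ∀ x y, deg y ≠ a → p x y = 0 := by
  classical
  obtain ⟨S0, hS0⟩ := exists_geninv D
  let S : Matrix X X k := fun x y => if P x ∧ P y ∧ deg x = deg y + 1 then S0 x y else 0
  have hSs : ∀ x y, S x y ≠ 0 → P x ∧ P y ∧ deg x = deg y + 1 := by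
    intro x y h
    by_contra h1
    exact h (if_neg h1)
  have hS : D * S * D = D := by
    ext x y
    by_cases hxy : deg y = deg x + 1
    · conv_rhs => rw [← hS0]
      simp only [Matrix.mul_apply]
      refine Finset.sum_congr rfl fun z _ => ?_
      by_cases hz : D z y = 0
      · simp [hz]
      congr 1
      refine Finset.sum_congr rfl fun w _ => ?_
      by_cases hw : D x w = 0
      · simp [hw]
      congr 1
      have h1 := hD _ _ hz
      have h2 := hD _ _ hw
      refine if_pos ⟨h2.2.1, h1.1, ?_⟩
      omega
    · have : D x y = 0 := by
        by_contra h; exact hxy (hD _ _ h).2.2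
      rw [this]
      simp only [Matrix.mul_apply]
      refine Finset.sum_eq_zero fun z _ => ?_
      by_cases hz : D z y = 0
      · simp [hz]
      rw [Finset.sum_eq_zero, zero_mul]
      intro w _
      by_cases hw : D x w = 0
      · simp [hw]
      have h1 := hD _ _ hz
      have h2 := hD _ _ hw
      have : S w z = 0 := by
        by_contra h
        have := hSs _ _ h
        omega
      simp [this]
  set π := piM k P with hπ
  set ε := epsM k deg with hε
  have πD : π * D = D := piM_mul_of _ _ fun x y h => (hD x y h).1
  have Dπ : D * π = D := mul_piM_of _ _ fun x y h => (hD x y h).2.1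
  have πS : π * S = S := piM_mul_of _ _ fun x y h => (hSs x y h).1
  have Sπ : S * π = S := mul_piM_of _ _ fun x y h => (hSs x y h).2.1
  have ππ : π * π = π := piM_idem _
  have πε : π * ε = ε * π := piM_eps _ _
  have εD : ε * D = -(D * ε) := eps_anti _ _ fun x y h => Or.inl (hD x y h).2.2
  have εS : ε * S = -(S * ε) := eps_anti _ _ fun x y h => Or.inr (hSs x y h).2.2
  have hp : (π - D * S) * (π - S * D) = π - D * S - S * D + D * S * (S * D) := by
    rw [sub_mul, mul_sub, mul_sub, ππ, ← mul_assoc π S D, πS, mul_assoc D S π, Sπ]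
    abel
  have ε1 : ∀ M N : Matrix X X k, ε * M = -(M * ε) → ε * N = -(N * ε) →
      ε * (M * N) = (M * N) * ε := by
    intro M N h1 h2
    rw [← mul_assoc, h1, neg_mul, mul_assoc, h2, mul_neg, neg_neg, mul_assoc]
  have εDS := ε1 _ _ εD εS
  have εSD := ε1 _ _ εS εD
  refine ⟨S - S * (S * D), (π - D * S) * (π - S * D), ?_, ?_, ?_, ?_, ?_, ?_, ?_, ?_, ?_, ?_⟩
  · rw [hp, mul_sub, sub_mul, mul_assoc S (S * D) D, mul_assoc S D D, hDD, mul_assoc D S (S * D)]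
    simp only [mul_zero]
    abel
  · rw [← mul_assoc, mul_sub D π, Dπ, ← mul_assoc, hDD, zero_mul, sub_zero, mul_sub, Dπ, ← mul_assoc,
      hS, sub_self]
  · rw [mul_assoc, sub_mul π _ D, πD, mul_assoc S, hDD, mul_zero, sub_zero, sub_mul, πD, hS, sub_self]
  · rw [mul_sub, ← mul_assoc, πS]
  · rw [sub_mul, mul_assoc, mul_assoc S D, Dπ, Sπ]
  · rw [← mul_assoc, mul_sub π π, ππ, ← mul_assoc π D S, πD]
  · rw [mul_assoc, sub_mul π _ π, ππ, mul_assoc S D π, Dπ]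
  · rw [mul_sub, sub_mul, εS, ← mul_assoc ε, εS, neg_mul, mul_assoc S ε, εSD]
    simp only [mul_assoc]; abel
  · have h1 : ε * (π - D * S) = (π - D * S) * ε := by
      rw [mul_sub, sub_mul, εDS, πε]
    have h2 : ε * (π - S * D) = (π - S * D) * ε := by
      rw [mul_sub, sub_mul, εSD, πε]
    rw [← mul_assoc, h1, mul_assoc, h2, mul_assoc]
  · intro x y hy
    have hv := hex _ hy ((π - S * D) *ᵥ Pi.single y 1) ?_ ?_
    · obtain ⟨u, hu⟩ := hv
      have : ((π - D * S) * (π - S * D)) *ᵥ Pi.single y 1 = 0 := by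
        rw [← Matrix.mulVec_mulVec, ← hu, Matrix.mulVec_mulVec, sub_mul, πD, hS, sub_self,
          Matrix.zero_mulVec]
      have h2 := congrFun this x
      simpa using h2
    · intro z hz
      simp only [Matrix.mulVec_single_one, Matrix.col_apply, Matrix.sub_apply]
      have h1 : π z y = 0 := by
        by_contra h
        have hzy : z = y := by
          by_contra hne
          exact h (Matrix.diagonal_apply_ne _ hne)
        subst hzy
        refine hz ⟨?_, rfl⟩
        by_contra hP
        apply h
        simp [hπ, piM, hP]
      have h2 : (S * D) z y = 0 := by
        rw [Matrix.mul_apply]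
        refine Finset.sum_eq_zero fun w _ => ?_
        by_contra h
        have h1 := hSs _ _ (left_ne_zero_of_mul h)
        have h2 := hD _ _ (right_ne_zero_of_mul h)
        exact hz ⟨h1.1, by omega⟩
      rw [h1, h2, sub_zero]
    · rw [Matrix.mulVec_mulVec, mul_sub, Dπ, ← mul_assoc, hS, sub_self, Matrix.zero_mulVec]

/-- The differential of the tensor product. -/
noncomputable def totD (D1 : Matrix X X k) (P1 : X → Prop) (deg1 : X → ℕ) (D2 : Matrix Y Y k)
    (P2 : Y → Prop) : Matrix (X × Y) (X × Y) k :=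
  D1 ⊗ₖ piM k P2 + (epsM k deg1 * piM k P1) ⊗ₖ D2

theorem kunneth (D1 : Matrix X X k) (P1 : X → Prop) (deg1 : X → ℕ) (a : ℕ)
    (hD1 : ∀ x y, D1 x y ≠ 0 → P1 x ∧ P1 y ∧ deg1 y = deg1 x + 1) (hDD1 : D1 * D1 = 0)
    (hex1 : ∀ q, q ≠ a → ExactAt D1 P1 deg1 q)
    (D2 : Matrix Y Y k) (P2 : Y → Prop) (deg2 : Y → ℕ) (b : ℕ)
    (hD2 : ∀ x y, D2 x y ≠ 0 → P2 x ∧ P2 y ∧ deg2 y = deg2 x + 1) (hDD2 : D2 * D2 = 0)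
    (hex2 : ∀ q, q ≠ b → ExactAt D2 P2 deg2 q) (q : ℕ) (hq : q ≠ a + b) :
    ExactAt (totD D1 P1 deg1 D2 P2) (fun x => P1 x.1 ∧ P2 x.2) (fun x => deg1 x.1 + deg2 x.2) q := by
  classical
  obtain ⟨h, p, e1, e2, e3, e4, e5, e6, e7, e8, e9, e10⟩ := exists_homotopy D1 P1 deg1 a hD1 hDD1 hex1
  obtain ⟨h', p', f1, f2, f3, f4, f5, f6, f7, f8, f9, f10⟩ :=
    exists_homotopy D2 P2 deg2 b hD2 hDD2 hex2
  have πD1 : piM k P1 * D1 = D1 := piM_mul_of _ _ fun x y h => (hD1 x y h).1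
  have Dπ1 : D1 * piM k P1 = D1 := mul_piM_of _ _ fun x y h => (hD1 x y h).2.1
  have πD2 : piM k P2 * D2 = D2 := piM_mul_of _ _ fun x y h => (hD2 x y h).1
  have Dπ2 : D2 * piM k P2 = D2 := mul_piM_of _ _ fun x y h => (hD2 x y h).2.1
  have εD1 : epsM k deg1 * D1 = -(D1 * epsM k deg1) :=
    eps_anti _ _ fun x y h => Or.inl (hD1 x y h).2.2
  have ππ1 : piM k P1 * piM k P1 = piM k P1 := piM_idem _
  have ππ2 : piM k P2 * piM k P2 = piM k P2 := piM_idem _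
  have πε : piM k P1 * epsM k deg1 = epsM k deg1 * piM k P1 := piM_eps _ _
  have εε : epsM k deg1 * epsM k deg1 = 1 := epsM_sq _
  intro v hv hDv
  set T := totD D1 P1 deg1 D2 P2 with hT
  set H : Matrix (X × Y) (X × Y) k := h ⊗ₖ piM k P2 + (epsM k deg1 * p) ⊗ₖ h' with hH
  have key : T * H + H * T = piM k P1 ⊗ₖ piM k P2 - p ⊗ₖ p' := by
    rw [hT, hH, totD]
    set π1 := piM k P1
    set π2 := piM k P2
    set ε := epsM k deg1
    simp only [mul_add, add_mul, ← Matrix.mul_kronecker_mul]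
    have a1 : ε * π1 * h = ε * h := by rw [mul_assoc, e4]
    have a2 : h * (ε * π1) = - (ε * h) := by
      rw [← mul_assoc, ← neg_eq_iff_eq_neg.mpr e8, neg_mul, mul_assoc, e5]
    have a3 : D1 * (ε * p) = 0 := by
      rw [← mul_assoc, ← neg_eq_iff_eq_neg.mpr εD1, neg_mul, mul_assoc, e2, mul_zero, neg_zero]
    have a4 : ε * p * D1 = 0 := by rw [mul_assoc, e3, mul_zero]
    have a5 : ε * π1 * (ε * p) = p := by
      rw [← πε, mul_assoc, ← mul_assoc ε, εε, one_mul, e6]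
    have a6 : ε * p * (ε * π1) = p := by
      rw [e9, mul_assoc, ← mul_assoc ε, εε, one_mul, e7]
    rw [a1, a2, a3, a4, a5, a6, ππ2, Dπ2, πD2, f4, f5]
    have b1 : D1 * h = π1 - p - h * D1 := by rw [← e1]; abel
    have b2 : D2 * h' = π2 - p' - h' * D2 := by rw [← f1]; abel
    rw [b1, b2]
    ext ⟨x, y⟩ ⟨x', y'⟩
    simp only [Matrix.add_apply, Matrix.sub_apply, Matrix.neg_apply, Matrix.kroneckerMap_apply,
      Matrix.zero_apply]
    ring
  have key2 := congrArg (fun M => M *ᵥ v) key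
  simp only [Matrix.add_mulVec, Matrix.sub_mulVec, ← Matrix.mulVec_mulVec, hDv,
    Matrix.mulVec_zero, add_zero] at key2
  refine ⟨H *ᵥ v, key2.trans ?_⟩
  have c1 : (piM k P1 ⊗ₖ piM k P2) *ᵥ v = v := by
    rw [piM, piM, Matrix.diagonal_kronecker_diagonal]
    ext x
    rw [Matrix.mulVec_diagonal]
    by_cases hx : P1 x.1 ∧ P2 x.2
    · simp [hx.1, hx.2]
    · rw [hv x (fun h => hx h.1), mul_zero]
  have c2 : (p ⊗ₖ p') *ᵥ v = 0 := by
    ext x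
    simp only [Matrix.mulVec, dotProduct, Pi.zero_apply]
    refine Finset.sum_eq_zero fun y _ => ?_
    by_cases hy : deg1 y.1 + deg2 y.2 = q
    · rw [Matrix.kroneckerMap_apply]
      by_cases hy1 : deg1 y.1 = a
      · rw [f10 _ _ (by omega), mul_zero, zero_mul]
      · rw [e10 _ _ hy1, zero_mul, zero_mul]
    · rw [hv y (fun h => hy h.2), mul_zero]
  rw [c1, c2, sub_zero]

theorem totD_mulVec (D1 : Matrix X X k) (P1 : X → Prop) (deg1 : X → ℕ) (D2 : Matrix Y Y k)
    (P2 : Y → Prop) (v : X × Y → k) (x : X) (y : Y) [Decidable (P1 x)] [Decidable (P2 y)] :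
    (totD D1 P1 deg1 D2 P2 *ᵥ v) (x, y) =
      (if P2 y then ∑ x', D1 x x' * v (x', y) else 0) +
      (if P1 x then (-1) ^ deg1 x * ∑ y', D2 y y' * v (x, y') else 0) := by
  classical
  simp only [totD, piM, epsM, Matrix.add_mulVec, Pi.add_apply, Matrix.diagonal_mul_diagonal]
  congr 1
  · simp only [Matrix.mulVec, dotProduct, Fintype.sum_prod_type, Matrix.kroneckerMap_apply]
    split_ifs with h
    · refine Finset.sum_congr rfl fun x' _ => ?_
      rw [Finset.sum_eq_single y]
      · simp [h]
      · intro b _ hb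
        simp [Matrix.diagonal_apply_ne _ (Ne.symm hb)]
      · simp
    · refine Finset.sum_eq_zero fun x' _ => Finset.sum_eq_zero fun b _ => ?_
      by_cases hb : y = b
      · subst hb; simp [h]
      · simp [Matrix.diagonal_apply_ne _ hb]
  · simp only [Matrix.mulVec, dotProduct, Fintype.sum_prod_type, Matrix.kroneckerMap_apply]
    rw [Finset.sum_eq_single x]
    · split_ifs with h
      · rw [Finset.mul_sum]
        refine Finset.sum_congr rfl fun x' _ => ?_
        simp [h, mul_assoc]
      · simp [h]
    · intro b _ hb
      refine Finset.sum_eq_zero fun y' _ => ?_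
      simp [Matrix.diagonal_apply_ne _ (Ne.symm hb)]
    · simp

theorem exact_left (D1 : Matrix X X k) (P1 : X → Prop) (deg1 : X → ℕ)
    (hD1 : ∀ x y, D1 x y ≠ 0 → P1 x ∧ P1 y ∧ deg1 y = deg1 x + 1)
    (P2 : Y → Prop) (deg2 : Y → ℕ) (y0 : Y) (hy0 : ∀ y, P2 y ↔ y = y0) (q : ℕ)
    (hex : ExactAt (totD D1 P1 deg1 (0 : Matrix Y Y k) P2) (fun x => P1 x.1 ∧ P2 x.2)
      (fun x => deg1 x.1 + deg2 x.2) (q + deg2 y0)) : ExactAt D1 P1 deg1 q := by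
  classical
  intro v hv hDv
  have hh := hex (fun x => if x.2 = y0 then v x.1 else 0) ?_ ?_
  · obtain ⟨u, hu⟩ := hh
    refine ⟨fun x => u (x, y0), ?_⟩
    ext x
    have := congrFun hu (x, y0)
    rw [totD_mulVec] at this
    simpa [hy0, Matrix.mulVec, dotProduct] using this
  · rintro ⟨x, y⟩ h
    by_cases hy : y = y0
    · subst hy
      simp only [if_true]
      apply hv
      rintro ⟨h1, h2⟩
      exact h ⟨⟨h1, (hy0 _).2 rfl⟩, by simp [h2]⟩
    · simp [hy]
  · ext ⟨x, y⟩
    rw [totD_mulVec]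
    simp only [hy0, Matrix.zero_apply, zero_mul, Finset.sum_const_zero, mul_zero, ite_self, add_zero]
    split_ifs with h
    · exact congrFun hDv x
    · rfl

theorem exact_right (D2 : Matrix Y Y k) (P2 : Y → Prop) (deg2 : Y → ℕ)
    (hD2 : ∀ x y, D2 x y ≠ 0 → P2 x ∧ P2 y ∧ deg2 y = deg2 x + 1)
    (P1 : X → Prop) (deg1 : X → ℕ) (x0 : X) (hx0 : ∀ x, P1 x ↔ x = x0) (q : ℕ)
    (hex : ExactAt (totD (0 : Matrix X X k) P1 deg1 D2 P2) (fun x => P1 x.1 ∧ P2 x.2)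
      (fun x => deg1 x.1 + deg2 x.2) (deg1 x0 + q)) : ExactAt D2 P2 deg2 q := by
  classical
  intro v hv hDv
  have hh := hex (fun x => if x.1 = x0 then v x.2 else 0) ?_ ?_
  · obtain ⟨u, hu⟩ := hh
    refine ⟨fun y => (-1) ^ deg1 x0 * u (x0, y), ?_⟩
    ext y
    have := congrFun hu (x0, y)
    rw [totD_mulVec] at this
    simp only [hx0, Matrix.zero_apply, zero_mul, Finset.sum_const_zero, ite_self, zero_add,
      if_true, Finset.mul_sum] at this
    rw [← this]
    simp only [Matrix.mulVec, dotProduct]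
    refine Finset.sum_congr rfl fun z _ => ?_
    ring
  · rintro ⟨x, y⟩ h
    by_cases hx : x = x0
    · subst hx
      simp only [if_true]
      apply hv
      rintro ⟨h1, h2⟩
      exact h ⟨⟨(hx0 _).2 rfl, h1⟩, by simp [h2]⟩
    · simp [hx]
  · ext ⟨x, y⟩
    rw [totD_mulVec]
    simp only [hx0, Matrix.zero_apply, zero_mul, Finset.sum_const_zero, ite_self, zero_add]
    split_ifs with h
    · have := congrFun hDv y
      simp only [Matrix.mulVec, dotProduct, Pi.zero_apply] at this
      simp [this]
    · rfl

theorem exactAt_equiv (φ : X ≃ Y) (D : Matrix Y Y k) (P : Y → Prop) (deg : Y → ℕ) (q : ℕ) :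
    ExactAt (D.submatrix φ φ) (P ∘ φ) (deg ∘ φ) q ↔ ExactAt D P deg q := by
  have hmv : ∀ v : X → k, D.submatrix φ φ *ᵥ v = (D *ᵥ (v ∘ φ.symm)) ∘ φ := fun v =>
    Matrix.submatrix_mulVec_equiv D v φ φ
  constructor
  · intro h v hv hDv
    obtain ⟨u, hu⟩ := h (v ∘ φ) (fun x hx => hv _ hx) (by
      rw [hmv, Function.comp_assoc, Equiv.self_comp_symm, Function.comp_id, hDv]; rfl)
    refine ⟨u ∘ φ.symm, ?_⟩
    rw [hmv] at hu
    ext y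
    simpa using congrFun hu (φ.symm y)
  · intro h v hv hDv
    obtain ⟨u, hu⟩ := h (v ∘ φ.symm) (fun y hy => hv _ (by simpa using hy)) (by
      rw [hmv] at hDv
      ext y
      simpa using congrFun hDv (φ.symm y))
    refine ⟨u ∘ φ, ?_⟩
    rw [hmv, Function.comp_assoc, Equiv.self_comp_symm, Function.comp_id, hu]
    ext; simp

end Abstract

section Simplicial
open Matrix

variable {k : Type} [Field k] {V : Type} [LinearOrder V] [Fintype V]

/-- The sign of inserting `x` into `F`. -/
def sgn (k : Type) [Field k] (x : V) (F : Finset V) : k :=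
  (-1) ^ (F.filter (fun y => y < x)).card

theorem sgn_sq (x : V) (F : Finset V) : sgn k x F * sgn k x F = 1 := by
  simp [sgn, ← mul_pow]

theorem sgn_swap (x y : V) (F : Finset V) (hx : x ∉ F) (hy : y ∉ F) (hxy : x ≠ y) :
    sgn k x F * sgn k y (insert x F) = - (sgn k y F * sgn k x (insert y F)) := by
  unfold sgn
  rw [Finset.filter_insert, Finset.filter_insert]
  rcases lt_or_gt_of_ne hxy with h | h
  · rw [if_pos h, if_neg (not_lt.2 h.le), Finset.card_insert_of_notMem (by simp [hx])]
    ring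
  · rw [if_pos h, if_neg (not_lt.2 h.le), Finset.card_insert_of_notMem (by simp [hy])]
    ring

/-- The boundary matrix of the full simplex. -/
noncomputable def bM (k : Type) [Field k] (V : Type) [LinearOrder V] [Fintype V] :
    Matrix (Finset V) (Finset V) k :=
  fun F G => ∑ x, if x ∉ F ∧ insert x F = G then sgn k x F else 0

theorem bM_mulVec (v : Finset V → k) (F : Finset V) :
    (bM k V *ᵥ v) F = ∑ x, if x ∉ F then sgn k x F * v (insert x F) else 0 := by
  simp only [Matrix.mulVec, dotProduct, bM, Finset.sum_mul]
  rw [Finset.sum_comm]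
  refine Finset.sum_congr rfl fun x _ => ?_
  rw [Finset.sum_eq_single (insert x F)]
  · simp [ite_mul]
  · intro G _ hG
    rw [if_neg (fun h => hG h.2.symm), zero_mul]
  · simp

theorem bM_ne {F G : Finset V} (h : bM k V F G ≠ 0) : ∃ x, x ∉ F ∧ insert x F = G := by
  obtain ⟨x, -, hx⟩ := Finset.exists_ne_zero_of_sum_ne_zero h
  refine ⟨x, ?_⟩
  by_contra h'
  exact hx (if_neg h')

theorem bM_bM (v : Finset V → k) : bM k V *ᵥ (bM k V *ᵥ v) = 0 := by
  ext F
  rw [bM_mulVec]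
  simp only [bM_mulVec, Pi.zero_apply]
  have : ∀ x, (if x ∉ F then sgn k x F * ∑ y, (if y ∉ insert x F then
      sgn k y (insert x F) * v (insert y (insert x F)) else 0) else 0) =
      ∑ y, if x ∉ F ∧ y ∉ F ∧ x ≠ y then
        sgn k x F * sgn k y (insert x F) * v (insert y (insert x F)) else 0 := by
    intro x
    by_cases hx : x ∉ F
    · rw [if_pos hx, Finset.mul_sum]
      refine Finset.sum_congr rfl fun y _ => ?_
      by_cases hy : y ∈ F
      · simp [hy]
      · by_cases hxy : x = y
        · simp [hxy]
        · have : y ≠ x := fun h => hxy h.symm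
          simp [hx, hy, hxy, this, mul_assoc]
    · rw [if_neg hx]; simp [hx]
  rw [Finset.sum_congr rfl fun x _ => this x, ← Finset.sum_product']
  refine Finset.sum_involution (fun p _ => (p.2, p.1)) ?_ ?_ ?_ ?_
  · rintro ⟨x, y⟩ -
    simp only
    by_cases h : x ∉ F ∧ y ∉ F ∧ x ≠ y
    · rw [if_pos h, if_pos ⟨h.2.1, h.1, h.2.2.symm⟩, sgn_swap x y F h.1 h.2.1 h.2.2,
        Finset.insert_comm x y]
      ring
    · rw [if_neg h, if_neg (fun h' => h ⟨h'.2.1, h'.1, h'.2.2.symm⟩), add_zero]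
  · rintro ⟨x, y⟩ - h h'
    simp only [Prod.mk.injEq] at h'
    apply h
    simp [h'.1]
  · simp
  · simp

/-- The cone operator with apex `w`. -/
def coneOp (w : V) (v : Finset V → k) : Finset V → k :=
  fun F => if w ∈ F then sgn k w (F.erase w) * v (F.erase w) else 0

theorem bM_cone (w : V) (v : Finset V → k) (hv : bM k V *ᵥ v = 0) :
    bM k V *ᵥ coneOp w v = v := by
  ext F
  rw [bM_mulVec]
  by_cases hw : w ∈ F
  · have h0 := congrFun hv (F.erase w)
    rw [bM_mulVec, Pi.zero_apply, ← Finset.add_sum_erase _ _ (Finset.mem_univ w)] at h0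
    rw [← Finset.add_sum_erase _ _ (Finset.mem_univ w)]
    simp only [Finset.notMem_erase, not_false_eq_true, if_true, Finset.insert_erase hw] at h0
    simp only [hw, not_true_eq_false, if_false, zero_add]
    have h1 : ∀ x ∈ Finset.univ.erase w,
        (if x ∉ F then sgn k x F * coneOp w v (insert x F) else 0) =
        - (sgn k w (F.erase w) * if x ∉ F.erase w then
          sgn k x (F.erase w) * v (insert x (F.erase w)) else 0) := by
      intro x hx
      have hxw : x ≠ w := (Finset.mem_erase.1 hx).1
      by_cases hxF : x ∈ F
      · simp [hxF, hxw]
      · have hxF' : x ∉ F.erase w := fun h => hxF (Finset.mem_of_mem_erase h)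
        rw [if_pos hxF, if_pos hxF', coneOp, if_pos (Finset.mem_insert_of_mem hw),
          Finset.erase_insert_of_ne hxw]
        have h2 := sgn_swap (k := k) w x (F.erase w) (Finset.notMem_erase w F) hxF' hxw.symm
        rw [Finset.insert_erase hw] at h2
        have h3 := sgn_sq (k := k) w (F.erase w)
        have h4 := sgn_sq (k := k) w (insert x (F.erase w))
        linear_combination (sgn k w (insert x (F.erase w)) * v (insert x (F.erase w)) *
          sgn k w (F.erase w)) * h2 -
          (sgn k x F * sgn k w (insert x (F.erase w)) * v (insert x (F.erase w))) * h3 -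
          (sgn k w (F.erase w) * sgn k x (F.erase w) * v (insert x (F.erase w))) * h4
    rw [Finset.sum_congr rfl h1, Finset.sum_neg_distrib, ← Finset.mul_sum]
    have h3 := sgn_sq (k := k) w (F.erase w)
    linear_combination (-sgn k w (F.erase w)) * h0 + v F * h3
  · rw [Finset.sum_eq_single w]
    · rw [if_pos hw, coneOp, if_pos (Finset.mem_insert_self _ _), Finset.erase_insert hw,
        ← mul_assoc, sgn_sq, one_mul]
    · intro x _ hx
      have : w ∉ insert x F := by simp [hw, hx.symm]
      simp [coneOp, this]
    · simp

/-- Support in a down-closed set is preserved by the boundary. -/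
theorem bM_supp (K : Finset V → Prop) (hK : ∀ F G, F ⊆ G → K G → K F) (v : Finset V → k)
    (hv : ∀ F, ¬ K F → v F = 0) (F : Finset V) (hF : ¬ K F) : (bM k V *ᵥ v) F = 0 := by
  rw [bM_mulVec]
  refine Finset.sum_eq_zero fun x _ => ?_
  rw [hv _ (fun h => hF (hK _ _ (Finset.subset_insert x F) h)), mul_zero, ite_self]

theorem bM_deg (q : ℕ) (v : Finset V → k) (hv : ∀ F, F.card ≠ q + 1 → v F = 0)
    (F : Finset V) (hF : F.card ≠ q) : (bM k V *ᵥ v) F = 0 := by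
  rw [bM_mulVec]
  refine Finset.sum_eq_zero fun x _ => ?_
  by_cases hx : x ∉ F
  · rw [if_pos hx, hv _ (by rw [Finset.card_insert_of_notMem hx]; omega), mul_zero]
  · rw [if_neg hx]

open scoped Classical in
/-- The relative boundary matrix. -/
noncomputable def relM (k : Type) [Field k] (P : Finset V → Prop) :
    Matrix (Finset V) (Finset V) k :=
  fun F G => if P F ∧ P G then bM k V F G else 0

/-- The nonfaces inside `W`. -/
def NP (E : Set (Finset V)) (W : Finset V) (F : Finset V) : Prop :=
  F ⊆ W ∧ ∃ e ∈ E, e ⊆ F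

theorem relM_supp (P : Finset V → Prop) (F G : Finset V) (h : relM k P F G ≠ 0) :
    P F ∧ P G ∧ G.card = F.card + 1 := by
  unfold relM at h
  split_ifs at h with hP
  · obtain ⟨x, hx, rfl⟩ := bM_ne h
    exact ⟨hP.1, hP.2, Finset.card_insert_of_notMem hx⟩
  · exact absurd rfl h

open scoped Classical in
theorem relM_mulVec (P : Finset V → Prop) (v : Finset V → k) (F : Finset V) :
    (relM k P *ᵥ v) F = if P F then (bM k V *ᵥ (fun G => if P G then v G else 0)) F else 0 := by
  simp only [Matrix.mulVec, dotProduct, relM]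
  split_ifs with h
  · refine Finset.sum_congr rfl fun G _ => ?_
    by_cases hG : P G <;> simp [h, hG]
  · simp [h]

theorem relM_eq (E : Set (Finset V)) (W : Finset V) (v : Finset V → k)
    (hv : ∀ F, ¬ F ⊆ W → v F = 0) (F : Finset V) (hF : NP E W F) :
    (relM k (NP E W) *ᵥ v) F = (bM k V *ᵥ v) F := by
  classical
  rw [relM_mulVec, if_pos hF, bM_mulVec, bM_mulVec]
  refine Finset.sum_congr rfl fun x _ => ?_
  have : (if NP E W (insert x F) then v (insert x F) else 0) = v (insert x F) := by
    split_ifs with h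
    · rfl
    · symm
      apply hv
      intro h'
      obtain ⟨e, he, heF⟩ := hF.2
      exact h ⟨h', e, he, heF.trans (Finset.subset_insert _ _)⟩
  rw [this]

theorem relM_sq (E : Set (Finset V)) (W : Finset V) :
    relM k (NP E W) * relM k (NP E W) = 0 := by
  classical
  have h0 : bM k V * bM k V = 0 := by
    ext F G
    have := congrFun (bM_bM (k := k) (V := V) (Pi.single G 1)) F
    rw [Matrix.mulVec_mulVec] at this
    simpa using this
  ext F H
  rw [Matrix.mul_apply, Matrix.zero_apply]
  by_cases hF : NP E W F
  · by_cases hH : NP E W H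
    · have h1 := congrFun (congrFun h0 F) H
      rw [Matrix.mul_apply, Matrix.zero_apply] at h1
      rw [← h1]
      refine Finset.sum_congr rfl fun G _ => ?_
      by_cases hG : NP E W G
      · simp [relM, hF, hG, hH]
      · have : bM k V F G * bM k V G H = 0 := by
          by_contra h
          obtain ⟨x, -, rfl⟩ := bM_ne (left_ne_zero_of_mul h)
          obtain ⟨y, -, rfl⟩ := bM_ne (right_ne_zero_of_mul h)
          obtain ⟨e, he, heF⟩ := hF.2
          exact hG ⟨(Finset.subset_insert _ _).trans hH.1, e, he,
            heF.trans (Finset.subset_insert _ _)⟩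
        rw [this]
        simp [relM, hG]
    · refine Finset.sum_eq_zero fun G _ => ?_
      simp [relM, hH]
  · refine Finset.sum_eq_zero fun G _ => ?_
    simp [relM, hF]

/-- Vanishing of homology for the restricted independence complex, with functions. -/
def AbsEx (k : Type) [Field k] (K : Set (Finset V)) (q : ℕ) : Prop :=
  ∀ v : Finset V → k, (∀ F, ¬ (F ∈ K ∧ F.card = q) → v F = 0) → bM k V *ᵥ v = 0 →
    ∃ u : Finset V → k, (∀ F, F ∉ K → u F = 0) ∧ bM k V *ᵥ u = v

theorem not_mem_restr (E : Set (Finset V)) (W F : Finset V) :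
    F ∉ restrictC (indepComplex E) W ↔ ¬ F ⊆ W ∨ NP E W F := by
  simp only [restrictC, indepComplex, NP, Set.mem_ofPred_eq]
  by_cases h : F ⊆ W <;> simp [h]

theorem restr_down (E : Set (Finset V)) (W F G : Finset V) (h : F ⊆ G)
    (hG : G ∈ restrictC (indepComplex E) W) : F ∈ restrictC (indepComplex E) W :=
  ⟨fun e he hF => hG.1 e he (hF.trans h), h.trans hG.2⟩

theorem abs_iff_rel (E : Set (Finset V)) (W : Finset V) (hW : W.Nonempty) (q : ℕ) :
    AbsEx k (restrictC (indepComplex E) W) q ↔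
      ExactAt (relM k (NP E W)) (NP E W) Finset.card (q + 1) := by
  classical
  obtain ⟨w, hw⟩ := hW
  have hdown : ∀ F G : Finset V, F ⊆ G → G ⊆ W → F ⊆ W := fun F G h1 h2 => h1.trans h2
  have hcone : ∀ v : Finset V → k, (∀ F, ¬ F ⊆ W → v F = 0) →
      ∀ F, ¬ F ⊆ W → coneOp w v F = 0 := by
    intro v hv F hF
    unfold coneOp
    split_ifs with hwF
    · rw [hv, mul_zero]
      intro h
      apply hF
      rw [← Finset.insert_erase hwF]
      exact Finset.insert_subset hw h
    · rfl
  constructor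
  · intro h v hv hDv
    have hvW : ∀ F, ¬ F ⊆ W → v F = 0 := fun F hF => hv F fun h => hF h.1.1
    obtain ⟨u, hu1, hu2⟩ := h (bM k V *ᵥ v) (by
      intro F hF
      by_cases hq : F.card = q
      · rcases (not_mem_restr E W F).1 (fun h => hF ⟨h, hq⟩) with h1 | h1
        · exact bM_supp (fun F => F ⊆ W) hdown v hvW F h1
        · rw [← relM_eq E W v hvW F h1, hDv]; rfl
      · exact bM_deg q v (fun F hF => hv F fun h => hF h.2) F hq) (bM_bM v)
    have huW : ∀ F, ¬ F ⊆ W → u F = 0 := fun F hF => hu1 F fun h => hF h.2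
    have hvu : ∀ F, ¬ F ⊆ W → (v - u) F = 0 := fun F hF => by simp [hvW F hF, huW F hF]
    have h1 := bM_cone w (v - u) (by rw [Matrix.mulVec_sub, hu2, sub_self])
    refine ⟨coneOp w (v - u), ?_⟩
    ext F
    by_cases hF : NP E W F
    · rw [relM_eq E W _ (hcone _ hvu) F hF, h1, Pi.sub_apply,
        hu1 F ((not_mem_restr E W F).2 (Or.inr hF)), sub_zero]
    · rw [relM_mulVec, if_neg hF, hv F (fun h => hF h.1)]
  · intro h v hv hDv
    have hvW : ∀ F, ¬ F ⊆ W → v F = 0 := fun F hF => hv F fun h => hF h.1.2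
    have hz := bM_cone w v hDv
    set z := coneOp w v with hzdef
    have hzW : ∀ F, ¬ F ⊆ W → z F = 0 := hcone v hvW
    have hcut : ∀ t : Finset V → k, relM k (NP E W) *ᵥ (fun G => if NP E W G then t G else 0) =
        relM k (NP E W) *ᵥ t := by
      intro t
      ext F
      rw [relM_mulVec, relM_mulVec]
      congr 3
      ext G
      split_ifs <;> rfl
    obtain ⟨u, hu⟩ := h (fun G => if NP E W G then z G else 0) (by
      intro F hF
      split_ifs with hN
      · simp only [hzdef, coneOp]
        split_ifs with hwF
        · rw [hv, mul_zero]
          intro h'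
          apply hF
          refine ⟨hN, ?_⟩
          have := Finset.card_erase_add_one hwF
          omega
        · rfl
      · rfl) (by
      rw [hcut]
      ext F
      by_cases hN : NP E W F
      · rw [relM_eq E W z hzW F hN, hz, Pi.zero_apply]
        exact hv F fun h => (not_mem_restr E W F).2 (Or.inr hN) h.1
      · rw [relM_mulVec, if_neg hN]; rfl)
    set u' : Finset V → k := fun G => if NP E W G then u G else 0 with hu'
    have hu'W : ∀ F, ¬ F ⊆ W → u' F = 0 := fun F hF => if_neg fun h => hF h.1
    refine ⟨z - bM k V *ᵥ u', ?_, ?_⟩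
    · intro F hF
      rw [Pi.sub_apply]
      by_cases hFW : F ⊆ W
      · have hN : NP E W F := by
          rcases (not_mem_restr E W F).1 hF with h1 | h1
          · exact absurd hFW h1
          · exact h1
        rw [← relM_eq E W u' hu'W F hN, hu', hcut, hu]
        simp [hN]
      · rw [hzW F hFW, bM_supp (fun F => F ⊆ W) hdown u' hu'W F hFW, sub_zero]
    · rw [Matrix.mulVec_sub, hz, bM_bM, sub_zero]

/-- Chains as functions. -/
noncomputable def extL (k : Type) [Field k] (K : Set (Finset V)) (i : ℕ) :
    Chains k K i →ₗ[k] (Finset V → k) :=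
  Finsupp.lcoeFun ∘ₗ Finsupp.lmapDomain k k Subtype.val

theorem extL_single (K : Set (Finset V)) (i : ℕ) (F : {F : Finset V // F ∈ K ∧ F.card = i})
    (a : k) : extL k K i (Finsupp.single F a) = Pi.single F.1 a := by
  simp [extL, Finsupp.mapDomain_single, Finsupp.single_eq_pi_single]

theorem extL_inj (K : Set (Finset V)) (i : ℕ) : Function.Injective (extL k K i) := by
  intro a b h
  apply Finsupp.mapDomain_injective Subtype.val_injective
  exact DFunLike.coe_injective h

theorem extL_supp (K : Set (Finset V)) (i : ℕ) (c : Chains k K i) (F : Finset V)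
    (hF : ¬ (F ∈ K ∧ F.card = i)) : extL k K i c F = 0 := by
  change Finsupp.mapDomain Subtype.val c F = 0
  apply Finsupp.mapDomain_of_notMem_range
  rintro ⟨⟨G, hG⟩, rfl⟩
  exact hF hG

theorem extL_surj (K : Set (Finset V)) (i : ℕ) (v : Finset V → k)
    (hv : ∀ F, ¬ (F ∈ K ∧ F.card = i) → v F = 0) : ∃ c, extL k K i c = v := by
  classical
  refine ⟨Finsupp.equivFunOnFinite.symm fun F => v F.1, ?_⟩
  ext F
  by_cases hF : F ∈ K ∧ F.card = i
  · change Finsupp.mapDomain Subtype.val _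
      (Subtype.val (⟨F, hF⟩ : {F : Finset V // F ∈ K ∧ F.card = i})) = _
    rw [Finsupp.mapDomain_apply Subtype.val_injective]
    rfl
  · rw [extL_supp _ _ _ _ hF, hv F hF]

theorem extL_boundary (K : Set (Finset V)) (hK : ∀ F G : Finset V, F ⊆ G → G ∈ K → F ∈ K)
    (i : ℕ) (c : Chains k K (i + 1)) :
    extL k K i (boundary k K i c) = bM k V *ᵥ extL k K (i + 1) c := by
  classical
  have : extL k K i ∘ₗ boundary k K i = (bM k V).mulVecLin ∘ₗ extL k K (i + 1) := by
    apply Finsupp.lhom_ext'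
    intro G
    apply LinearMap.ext_ring
    simp only [LinearMap.comp_apply, Finsupp.lsingle_apply, extL_single, Matrix.mulVecLin_apply]
    have h1 : boundary k K i (Finsupp.single G 1) = elemBoundary k K i G := by
      simp [boundary]
    rw [h1, elemBoundary, map_sum]
    ext F
    rw [Matrix.mulVec_single_one, Matrix.col_apply, Finset.sum_apply, bM]
    have h2 : ∀ x ∈ G.1.attach, (extL k K i (if h : G.1.erase x.1 ∈ K then
      ((-1 : k) ^ (G.1.filter (fun y => y < x.1)).card) •
        Finsupp.single ⟨G.1.erase x.1, ⟨h, by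
          simp [Finset.card_erase_of_mem x.2, G.2.2]⟩⟩ (1 : k)
      else 0)) F = (fun x : V => if G.1.erase x = F then sgn k x F else 0) x.1 := by
      intro x _
      rw [dif_pos (hK _ _ (Finset.erase_subset _ _) G.2.1), map_smul, extL_single, Pi.smul_apply,
        Pi.single_apply]
      by_cases hx : G.1.erase x.1 = F
      · subst hx
        simp only [if_true, smul_eq_mul, mul_one, sgn]
        congr 2
        ext y
        simp only [Finset.mem_filter, Finset.mem_erase]
        constructor
        · rintro ⟨h1, h2⟩; exact ⟨⟨h2.ne, h1⟩, h2⟩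
        · rintro ⟨h1, h2⟩; exact ⟨h1.2, h2⟩
      · simp [hx, Ne.symm hx]
    refine (Finset.sum_congr rfl h2).trans ?_
    rw [Finset.sum_attach G.1 (fun x : V => if G.1.erase x = F then sgn k x F else 0)]
    rw [← Finset.sum_subset (Finset.subset_univ G.1)]
    · refine Finset.sum_congr rfl fun x hx => ?_
      congr 1
      apply propext
      constructor
      · rintro rfl
        exact ⟨Finset.notMem_erase _ _, Finset.insert_erase hx⟩
      · rintro ⟨h1, h2⟩
        rw [← h2, Finset.erase_insert h1]
    · intro x _ hx
      apply if_neg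
      rintro ⟨h1, h2⟩
      apply hx
      rw [← h2]
      exact Finset.mem_insert_self _ _
  exact LinearMap.congr_fun this c

theorem mem_cycles_iff (K : Set (Finset V)) (hK : ∀ F G : Finset V, F ⊆ G → G ∈ K → F ∈ K)
    (i : ℕ) (c : Chains k K i) :
    c ∈ cyclesMod k K i ↔ bM k V *ᵥ extL k K i c = 0 := by
  cases i with
  | zero =>
    simp only [cyclesMod, Submodule.mem_top, true_iff]
    ext F
    rw [bM_mulVec]
    refine Finset.sum_eq_zero fun x _ => ?_
    rw [extL_supp K 0 c _ (by simp), mul_zero, ite_self]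
  | succ i =>
    rw [← extL_boundary K hK]
    simp only [cyclesMod, LinearMap.mem_ker]
    constructor
    · intro h; rw [h, map_zero]
    · intro h; exact extL_inj K i (by rw [h, map_zero])

theorem finrank_zero_iff (K : Set (Finset V)) (hK : ∀ F G : Finset V, F ⊆ G → G ∈ K → F ∈ K)
    (q : ℕ) : Module.finrank k (redHomology k K q) = 0 ↔ AbsEx k K q := by
  classical
  have hfin : Module.Finite k (Chains k K q) := inferInstance
  rw [Module.finrank_zero_iff, Submodule.Quotient.subsingleton_iff]
  constructor
  · intro h v hv hDv
    obtain ⟨c, rfl⟩ := extL_surj K q v hv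
    have hc := (mem_cycles_iff K hK q c).2 hDv
    have h1 : (⟨c, hc⟩ : cyclesMod k K q) ∈
      (LinearMap.range (boundary k K q)).comap (cyclesMod k K q).subtype := by
      rw [h]; trivial
    obtain ⟨b, hb⟩ := h1
    refine ⟨extL k K (q + 1) b, fun F hF => extL_supp _ _ _ _ fun h => hF h.1, ?_⟩
    rw [← extL_boundary K hK, hb]
    rfl
  · intro h
    rw [eq_top_iff]
    rintro ⟨c, hc⟩ -
    obtain ⟨u, hu1, hu2⟩ := h (extL k K q c) (fun F hF => extL_supp _ _ _ _ hF)
      ((mem_cycles_iff K hK q c).1 hc)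
    obtain ⟨b, hb⟩ := extL_surj K (q + 1) (fun F => if F.card = q + 1 then u F else 0) (by
      intro F hF
      split_ifs with h1
      · exact hu1 F fun h2 => hF ⟨h2, h1⟩
      · rfl)
    refine ⟨b, extL_inj K q ?_⟩
    rw [extL_boundary K hK, hb]
    change _ = extL k K q c
    ext F
    by_cases hF : F.card = q
    · rw [← hu2, bM_mulVec, bM_mulVec]
      refine Finset.sum_congr rfl fun x _ => ?_
      by_cases h1 : x ∉ F
      · rw [if_pos h1, if_pos h1, if_pos (by rw [Finset.card_insert_of_notMem h1, hF])]
      · rw [if_neg h1, if_neg h1]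
    · rw [bM_deg q _ (fun G hG => if_neg hG) F hF, extL_supp _ _ _ _ fun h => hF h.2]

end Simplicial

theorem linear_iff (k : Type) [Field k] {n : ℕ} (E : Set (Finset (Fin n))) (e : ℕ)
    (hE : ∀ f ∈ E, f.card = e) :
    HasLinearRes k E e ↔ ∀ (W : Finset (Fin n)) (q : ℕ), q ≠ e →
      ExactAt (relM k (NP E W)) (NP E W) Finset.card q := by
  have htriv : ∀ (W : Finset (Fin n)) (q : ℕ), (∀ F, NP E W F → F.card ≠ q) →
      ExactAt (relM k (NP E W)) (NP E W) Finset.card q := by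
    intro W q h v hv _
    refine ⟨0, ?_⟩
    rw [Matrix.mulVec_zero]
    ext F
    rw [hv F (fun h' => h F h'.1 h'.2)]
    rfl
  constructor
  · intro h W q hq
    cases q with
    | zero =>
      apply htriv
      rintro F ⟨-, f, hf, hfF⟩ h0
      have := Finset.card_le_card hfF
      have := hE f hf
      omega
    | succ q =>
      by_cases hqW : W.card ≤ q
      · apply htriv
        rintro F ⟨hF, -⟩ h0
        have := Finset.card_le_card hF
        omega
      · push Not at hqW
        have h1 := h (W.card - q) W.card (by omega) (by omega)
        rw [betti, if_pos (by omega), Finset.sum_eq_zero_iff] at h1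
        have h2 := h1 W (by simp)
        rw [show W.card - (W.card - q) = q by omega,
          finrank_zero_iff _ (fun F G => restr_down E W F G),
          abs_iff_rel E W (Finset.card_pos.1 (by omega))] at h2
        exact h2
  · intro h i j hi hij
    rw [betti]
    split_ifs with hle
    · refine Finset.sum_eq_zero fun W hW => ?_
      have hWj : W.card = j := (Finset.mem_filter.1 hW).2
      rw [finrank_zero_iff _ (fun F G => restr_down E W F G),
        abs_iff_rel E W (Finset.card_pos.1 (by omega))]
      exact h W _ (by omega)
    · rfl

section Product
open Matrix Kronecker

/-- Pairs of subsets as a subset of the disjoint union. -/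
def joinF {n m : ℕ} (p : Finset (Fin n) × Finset (Fin m)) : Finset (Fin (n + m)) :=
  p.1.image (Fin.castAdd m) ∪ p.2.image (Fin.natAdd n)

theorem castAdd_mem {n m : ℕ} (p : Finset (Fin n) × Finset (Fin m)) (x : Fin n) :
    Fin.castAdd m x ∈ joinF p ↔ x ∈ p.1 := by
  simp only [joinF, Finset.mem_union, Finset.mem_image]
  constructor
  · rintro (⟨y, hy, h⟩ | ⟨y, hy, h⟩)
    · rwa [← Fin.castAdd_injective _ _ h]
    · have := congrArg Fin.val h
      simp at this
      omega
  · intro h; exact Or.inl ⟨x, h, rfl⟩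

theorem natAdd_mem {n m : ℕ} (p : Finset (Fin n) × Finset (Fin m)) (x : Fin m) :
    Fin.natAdd n x ∈ joinF p ↔ x ∈ p.2 := by
  simp only [joinF, Finset.mem_union, Finset.mem_image]
  constructor
  · rintro (⟨y, hy, h⟩ | ⟨y, hy, h⟩)
    · have := congrArg Fin.val h
      simp at this
      omega
    · rwa [← Fin.natAdd_injective _ _ h]
  · intro h; exact Or.inr ⟨x, h, rfl⟩

theorem joinF_subset {n m : ℕ} (p q : Finset (Fin n) × Finset (Fin m)) :
    joinF p ⊆ joinF q ↔ p.1 ⊆ q.1 ∧ p.2 ⊆ q.2 := by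
  constructor
  · intro h
    refine ⟨fun x hx => ?_, fun x hx => ?_⟩
    · exact (castAdd_mem q x).1 (h ((castAdd_mem p x).2 hx))
    · exact (natAdd_mem q x).1 (h ((natAdd_mem p x).2 hx))
  · rintro ⟨h1, h2⟩ x
    induction x using Fin.addCases with
    | left x => rw [castAdd_mem, castAdd_mem]; exact fun h => h1 h
    | right x => rw [natAdd_mem, natAdd_mem]; exact fun h => h2 h

theorem joinF_inj {n m : ℕ} : Function.Injective (joinF (n := n) (m := m)) := by
  intro p q h
  have h1 := (joinF_subset p q).1 h.le
  have h2 := (joinF_subset q p).1 h.ge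
  exact Prod.ext (h1.1.antisymm h2.1) (h1.2.antisymm h2.2)

theorem joinF_surj {n m : ℕ} : Function.Surjective (joinF (n := n) (m := m)) := by
  intro F
  refine ⟨(Finset.univ.filter fun x => Fin.castAdd m x ∈ F,
    Finset.univ.filter fun x => Fin.natAdd n x ∈ F), ?_⟩
  ext x
  induction x using Fin.addCases with
  | left x => rw [castAdd_mem]; simp
  | right x => rw [natAdd_mem]; simp

/-- The equivalence between pairs of subsets and subsets of the disjoint union. -/
noncomputable def joinE (n m : ℕ) :
    Finset (Fin n) × Finset (Fin m) ≃ Finset (Fin (n + m)) :=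
  Equiv.ofBijective joinF ⟨joinF_inj, joinF_surj⟩

theorem joinF_card {n m : ℕ} (p : Finset (Fin n) × Finset (Fin m)) :
    (joinF p).card = p.1.card + p.2.card := by
  unfold joinF
  rw [Finset.card_union_of_disjoint, Finset.card_image_of_injective _ (Fin.castAdd_injective _ _),
    Finset.card_image_of_injective _ (Fin.natAdd_injective _ _)]
  rw [Finset.disjoint_left]
  intro x h1 h2
  obtain ⟨y, -, rfl⟩ := Finset.mem_image.1 h1
  obtain ⟨z, -, h⟩ := Finset.mem_image.1 h2
  have := congrArg Fin.val h
  simp at this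
  omega

theorem insert_castAdd {n m : ℕ} (p : Finset (Fin n) × Finset (Fin m)) (x : Fin n) :
    insert (Fin.castAdd m x) (joinF p) = joinF (insert x p.1, p.2) := by
  simp [joinF, Finset.image_insert, Finset.insert_union]

theorem insert_natAdd {n m : ℕ} (p : Finset (Fin n) × Finset (Fin m)) (x : Fin m) :
    insert (Fin.natAdd n x) (joinF p) = joinF (p.1, insert x p.2) := by
  simp [joinF, Finset.image_insert, Finset.union_insert]

theorem sgn_castAdd {k : Type} [Field k] {n m : ℕ} (p : Finset (Fin n) × Finset (Fin m))
    (x : Fin n) : sgn k (Fin.castAdd m x) (joinF p) = sgn k x p.1 := by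
  have : (joinF p).filter (fun y => y < Fin.castAdd m x) =
      joinF (p.1.filter (fun y => y < x), ∅) := by
    ext y
    induction y using Fin.addCases with
    | left y =>
      simp only [Finset.mem_filter, castAdd_mem]
      exact Iff.rfl
    | right y =>
      simp only [Finset.mem_filter, natAdd_mem, Fin.lt_def, Fin.val_natAdd, Fin.val_castAdd,
        Finset.notMem_empty, iff_false]
      omega
  rw [sgn, this, joinF_card]
  simp [sgn]

theorem sgn_natAdd {k : Type} [Field k] {n m : ℕ} (p : Finset (Fin n) × Finset (Fin m))
    (x : Fin m) : sgn k (Fin.natAdd n x) (joinF p) = (-1) ^ p.1.card * sgn k x p.2 := by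
  have : (joinF p).filter (fun y => y < Fin.natAdd n x) =
      joinF (p.1, p.2.filter (fun y => y < x)) := by
    ext y
    induction y using Fin.addCases with
    | left y =>
      simp only [Finset.mem_filter, castAdd_mem, Fin.lt_def, Fin.val_natAdd, Fin.val_castAdd,
        and_iff_left_iff_imp]
      omega
    | right y => simp [natAdd_mem]
  rw [sgn, this, joinF_card, pow_add]
  rfl

theorem NP_join {n m : ℕ} (E1 : Set (Finset (Fin n))) (E2 : Set (Finset (Fin m)))
    (W F : Finset (Fin n) × Finset (Fin m)) :
    NP (prodH E1 E2) (joinF W) (joinF F) ↔ NP E1 W.1 F.1 ∧ NP E2 W.2 F.2 := by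
  unfold NP
  rw [joinF_subset]
  constructor
  · rintro ⟨⟨h1, h2⟩, _, ⟨e, he, f, hf, rfl⟩, h⟩
    have h' : joinF (e, f) ⊆ joinF F := h
    rw [joinF_subset] at h'
    exact ⟨⟨h1, e, he, h'.1⟩, ⟨h2, f, hf, h'.2⟩⟩
  · rintro ⟨⟨h1, e, he, h1'⟩, ⟨h2, f, hf, h2'⟩⟩
    exact ⟨⟨h1, h2⟩, joinF (e, f), ⟨e, he, f, hf, rfl⟩, (joinF_subset _ _).2 ⟨h1', h2'⟩⟩

theorem bM_join {k : Type} [Field k] {n m : ℕ} (F G : Finset (Fin n) × Finset (Fin m)) :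
    bM k (Fin (n + m)) (joinF F) (joinF G) =
      (if F.2 = G.2 then bM k (Fin n) F.1 G.1 else 0) +
      (if F.1 = G.1 then (-1) ^ F.1.card * bM k (Fin m) F.2 G.2 else 0) := by
  unfold bM
  rw [Fin.sum_univ_add]
  congr 1
  · simp only [castAdd_mem, insert_castAdd, sgn_castAdd, joinF_inj.eq_iff, Prod.ext_iff]
    split_ifs with h
    · simp [h]
    · simp [h]
  · simp only [natAdd_mem, insert_natAdd, sgn_natAdd, joinF_inj.eq_iff, Prod.ext_iff]
    split_ifs with h
    · simp [h, Finset.mul_sum]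
    · simp [h]

theorem relM_join {k : Type} [Field k] {n m : ℕ} (E1 : Set (Finset (Fin n)))
    (E2 : Set (Finset (Fin m))) (W : Finset (Fin n) × Finset (Fin m)) :
    (relM k (NP (prodH E1 E2) (joinF W))).submatrix (joinE n m) (joinE n m) =
      totD (relM k (NP E1 W.1)) (NP E1 W.1) Finset.card (relM k (NP E2 W.2)) (NP E2 W.2) := by
  classical
  ext F G
  change relM k (NP (prodH E1 E2) (joinF W)) (joinF F) (joinF G) = _
  rw [relM, bM_join, totD, piM, piM, epsM, Matrix.diagonal_mul_diagonal, Matrix.add_apply,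
    Matrix.kroneckerMap_apply, Matrix.kroneckerMap_apply, Matrix.diagonal_apply,
    Matrix.diagonal_apply, relM, relM, NP_join, NP_join]
  obtain ⟨F1, F2⟩ := F
  obtain ⟨G1, G2⟩ := G
  simp only
  by_cases h1 : F1 = G1
  · subst h1
    have b1 : bM k (Fin n) F1 F1 = 0 := by
      by_contra h
      obtain ⟨x, hx, h2⟩ := bM_ne h
      exact hx (by rw [← h2]; exact Finset.mem_insert_self _ _)
    by_cases a1 : NP E1 W.1 F1 <;> by_cases a2 : NP E2 W.2 F2 <;> by_cases a3 : NP E2 W.2 G2 <;>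
      simp [a1, a2, a3, b1]
  · by_cases h2 : F2 = G2
    · subst h2
      by_cases a1 : NP E1 W.1 F1 <;> by_cases a2 : NP E1 W.1 G1 <;> by_cases a3 : NP E2 W.2 F2 <;>
        simp [a1, a2, a3, h1]
    · simp [h1, h2]

theorem exact_join {k : Type} [Field k] {n m : ℕ} (E1 : Set (Finset (Fin n)))
    (E2 : Set (Finset (Fin m))) (W : Finset (Fin n) × Finset (Fin m)) (q : ℕ) :
    ExactAt (relM k (NP (prodH E1 E2) (joinF W))) (NP (prodH E1 E2) (joinF W)) Finset.card q ↔
    ExactAt (totD (relM k (NP E1 W.1)) (NP E1 W.1) Finset.card (relM k (NP E2 W.2)) (NP E2 W.2))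
      (fun x => NP E1 W.1 x.1 ∧ NP E2 W.2 x.2) (fun x => x.1.card + x.2.card) q := by
  rw [← exactAt_equiv (joinE n m), relM_join]
  have h1 : NP (prodH E1 E2) (joinF W) ∘ joinE n m = fun x => NP E1 W.1 x.1 ∧ NP E2 W.2 x.2 := by
    ext x; exact NP_join E1 E2 W x
  have h2 : Finset.card ∘ joinE n m =
      fun x : Finset (Fin n) × Finset (Fin m) => x.1.card + x.2.card := by
    ext x; exact joinF_card x
  rw [h1, h2]

theorem NP_edge {n d : ℕ} (E : Set (Finset (Fin n))) (hu : ∀ e ∈ E, e.card = d)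
    (f : Finset (Fin n)) (hf : f ∈ E) (F : Finset (Fin n)) : NP E f F ↔ F = f := by
  constructor
  · rintro ⟨h1, e, he, h2⟩
    refine Finset.eq_of_subset_of_card_le h1 ?_
    rw [hu f hf, ← hu e he]
    exact Finset.card_le_card h2
  · rintro rfl
    exact ⟨subset_rfl, F, hf, subset_rfl⟩

theorem relM_edge {k : Type} [Field k] {n d : ℕ} (E : Set (Finset (Fin n)))
    (hu : ∀ e ∈ E, e.card = d) (f : Finset (Fin n)) (hf : f ∈ E) : relM k (NP E f) = 0 := by
  ext F G
  rw [Matrix.zero_apply]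
  by_contra h
  obtain ⟨h1, h2, h3⟩ := relM_supp _ _ _ h
  rw [NP_edge E hu f hf] at h1 h2
  subst h1 h2
  omega

end Product

/-- If `H` is a `d`-uniform hypergraph and `K` a `d'`-uniform hypergraph on disjoint
vertex sets (both with edges), then the product `H·K` is `(d+d')`-uniform, and it has a
linear resolution if and only if both `H` and `K` have linear resolutions. -/
theorem prod_uniform_and_linear_iff (k : Type) [Field k] (n m d d' : ℕ)
    (E1 : Set (Finset (Fin n))) (E2 : Set (Finset (Fin m)))
    (hne1 : E1.Nonempty) (hne2 : E2.Nonempty)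
    (hu1 : ∀ e ∈ E1, e.card = d) (hu2 : ∀ f ∈ E2, f.card = d') :
    (∀ S ∈ prodH E1 E2, S.card = d + d') ∧
      (HasLinearRes k (prodH E1 E2) (d + d') ↔
        HasLinearRes k E1 d ∧ HasLinearRes k E2 d') := by
  refine ⟨?_, ?_⟩
  · rintro S ⟨e, he, f, hf, rfl⟩
    rw [← hu1 e he, ← hu2 f hf]
    exact joinF_card (e, f)
  · have huP : ∀ S ∈ prodH E1 E2, S.card = d + d' := by
      rintro S ⟨e, he, f, hf, rfl⟩
      rw [← hu1 e he, ← hu2 f hf]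
      exact joinF_card (e, f)
    rw [linear_iff k _ _ huP, linear_iff k _ _ hu1, linear_iff k _ _ hu2]
    constructor
    · intro h
      obtain ⟨e, he⟩ := hne1
      obtain ⟨f, hf⟩ := hne2
      constructor
      · intro W q hq
        have h1 := h (joinF (W, f)) (q + f.card) (by rw [hu2 f hf]; omega)
        rw [exact_join, relM_edge E2 hu2 f hf] at h1
        exact exact_left _ _ _ (relM_supp _) _ _ f (NP_edge E2 hu2 f hf) q h1
      · intro W q hq
        have h1 := h (joinF (e, W)) (e.card + q) (by rw [hu1 e he]; omega)
        rw [exact_join, relM_edge E1 hu1 e he] at h1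
        exact exact_right _ _ _ (relM_supp _) _ _ e (NP_edge E1 hu1 e he) q h1
    · rintro ⟨h1, h2⟩ W q hq
      obtain ⟨W, rfl⟩ := joinF_surj W
      rw [exact_join]
      exact kunneth _ _ _ d (relM_supp _) (relM_sq _ _) (h1 W.1) _ _ _ d' (relM_supp _)
        (relM_sq _ _) (h2 W.2) q hq
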